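/- arXiv:2302.06809 — 2 statements merged into one kernel-verified Lean document; each statement's English description precedes it below -/
import Mathlib

section
/- Under the two-group random mixture model, let W_(1)≤…≤W_(n) be the order statistics of W1,…,Wn. For any τ∈(0,1) and any sequence of Markov kernels P_{K_n|X^n} from 𝒳^n to {0,1,…,n}, as n→∞ one has ((1/K_n)Σ_{i=1}^{K_n} W_(i) − a(K_n/n))·1{K_n ≥ τn} → 0 in probability and ((1/(n−K_n))Σ_{i=K_n+1}^n (1−W_(i)) − b(K_n/n))·1{K_n ≤ (1−τ)n} → 0 in probability. -/
open MeasureTheory ProbabilityTheory Filter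

namespace TwoGroup

/-- The two-group random mixture model: a σ-finite base measure on the sample space `𝒳`,
a null proportion `π0 ∈ (0,1)`, and null/non-null probability density functions `f0`, `f1`
with respect to the base measure. -/
structure Model (𝒳 : Type*) [MeasurableSpace 𝒳] where
  base : Measure 𝒳
  sigmaFinite : SigmaFinite base
  π0 : ℝ
  π0_mem : π0 ∈ Set.Ioo (0 : ℝ) 1
  f0 : 𝒳 → ℝ
  f1 : 𝒳 → ℝ
  f0_meas : Measurable f0
  f1_meas : Measurable f1
  f0_nonneg : ∀ x, 0 ≤ f0 x
  f1_nonneg : ∀ x, 0 ≤ f1 x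
  f0_prob : IsProbabilityMeasure (base.withDensity fun x => ENNReal.ofReal (f0 x))
  f1_prob : IsProbabilityMeasure (base.withDensity fun x => ENNReal.ofReal (f1 x))

namespace Model

variable {𝒳 : Type*} [MeasurableSpace 𝒳] (M : Model 𝒳)

/-- The non-null proportion `π1 = 1 - π0`. -/
noncomputable def π1 : ℝ := 1 - M.π0

/-- The marginal density `f = π0 f0 + π1 f1`. -/
noncomputable def f (x : 𝒳) : ℝ := M.π0 * M.f0 x + M.π1 * M.f1 x

/-- The local false discovery rate `Lfdr(x) = π0 f0(x) / f(x)`. -/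
noncomputable def Lfdr (x : 𝒳) : ℝ := M.π0 * M.f0 x / M.f x

/-- The joint law of a single pair `(θ, X)`; `true` encodes `θ = 1` (non-null). -/
noncomputable def joint : Measure (Bool × 𝒳) :=
  (ENNReal.ofReal M.π0) •
      ((Measure.dirac false).prod (M.base.withDensity fun x => ENNReal.ofReal (M.f0 x))) +
    (ENNReal.ofReal M.π1) •
      ((Measure.dirac true).prod (M.base.withDensity fun x => ENNReal.ofReal (M.f1 x)))

/-- The joint law of `((θ1, X1), …, (θn, Xn))`: i.i.d. copies of `(θ, X)`. -/
noncomputable def jointN (n : ℕ) : Measure (Fin n → Bool × 𝒳) :=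
  Measure.pi fun _ => M.joint

end Model

/-- Number of rejections `Σ_i δ_i`. -/
def nRej {n : ℕ} (d : Fin n → Bool) : ℝ := ∑ i, if d i then (1 : ℝ) else 0

/-- Number of false discoveries `Σ_i δ_i (1 - θ_i)`. -/
def nFD {n : ℕ} (θ d : Fin n → Bool) : ℝ :=
  ∑ i, (if d i then (1 : ℝ) else 0) * (if θ i then (0 : ℝ) else 1)

/-- Number of acceptances `Σ_i (1 - δ_i)`. -/
def nAcc {n : ℕ} (d : Fin n → Bool) : ℝ := ∑ i, if d i then (0 : ℝ) else 1

/-- Number of false non-discoveries `Σ_i (1 - δ_i) θ_i`. -/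
def nFN {n : ℕ} (θ d : Fin n → Bool) : ℝ :=
  ∑ i, (if d i then (0 : ℝ) else 1) * (if θ i then (1 : ℝ) else 0)

/-- False discovery proportion. -/
noncomputable def FDP {n : ℕ} (θ d : Fin n → Bool) : ℝ := nFD θ d / max 1 (nRej d)

/-- False non-discovery proportion. -/
noncomputable def FNP {n : ℕ} (θ d : Fin n → Bool) : ℝ := nFN θ d / max 1 (nAcc d)

/-- A decision rule is a Markov kernel from `𝒳^n` to `{0,1}^n`: a measurable family of
probability measures on `Fin n → Bool`. -/
def IsRule {𝒳 : Type*} [MeasurableSpace 𝒳] {n : ℕ}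
    (κ : (Fin n → 𝒳) → Measure (Fin n → Bool)) : Prop :=
  Measurable κ ∧ ∀ x, IsProbabilityMeasure (κ x)

namespace Model

variable {𝒳 : Type*} [MeasurableSpace 𝒳] (M : Model 𝒳)

/-- The false discovery rate `FDR = E[FDP]` of a (randomized) decision rule. -/
noncomputable def FDR (n : ℕ) (κ : (Fin n → 𝒳) → Measure (Fin n → Bool)) : ℝ :=
  ∫ ω, ∫ d, FDP (fun i => (ω i).1) d ∂(κ fun i => (ω i).2) ∂(M.jointN n)

/-- The false non-discovery rate `FNR = E[FNP]` of a (randomized) decision rule. -/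
noncomputable def FNR (n : ℕ) (κ : (Fin n → 𝒳) → Measure (Fin n → Bool)) : ℝ :=
  ∫ ω, ∫ d, FNP (fun i => (ω i).1) d ∂(κ fun i => (ω i).2) ∂(M.jointN n)

/-- The marginal FDR `mFDR = E[Σ δi (1-θi)] / E[Σ δi]` (with `0/0 = 0`). -/
noncomputable def mFDR (n : ℕ) (κ : (Fin n → 𝒳) → Measure (Fin n → Bool)) : ℝ :=
  (∫ ω, ∫ d, nFD (fun i => (ω i).1) d ∂(κ fun i => (ω i).2) ∂(M.jointN n)) /
    (∫ ω, ∫ d, nRej d ∂(κ fun i => (ω i).2) ∂(M.jointN n))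

/-- The marginal FNR `mFNR = E[Σ (1-δi) θi] / E[Σ (1-δi)]` (with `0/0 = 0`). -/
noncomputable def mFNR (n : ℕ) (κ : (Fin n → 𝒳) → Measure (Fin n → Bool)) : ℝ :=
  (∫ ω, ∫ d, nFN (fun i => (ω i).1) d ∂(κ fun i => (ω i).2) ∂(M.jointN n)) /
    (∫ ω, ∫ d, nAcc d ∂(κ fun i => (ω i).2) ∂(M.jointN n))

/-- `FNR*_n(α)`: the minimum FNR over decision rules controlling FDR at level `α`. -/
noncomputable def FNRstar (n : ℕ) (α : ℝ) : ℝ :=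
  sInf {r | ∃ κ : (Fin n → 𝒳) → Measure (Fin n → Bool),
    IsRule κ ∧ M.FDR n κ ≤ α ∧ r = M.FNR n κ}

/-- The minimum mFNR over decision rules for `n` hypotheses controlling mFDR at level `α`. -/
noncomputable def mFNRstarN (n : ℕ) (α : ℝ) : ℝ :=
  sInf {r | ∃ κ : (Fin n → 𝒳) → Measure (Fin n → Bool),
    IsRule κ ∧ M.mFDR n κ ≤ α ∧ r = M.mFNR n κ}

/-- `mFNR*(α)` (this quantity does not depend on the number of hypotheses; we take `n = 1`). -/
noncomputable def mFNRstar (α : ℝ) : ℝ := M.mFNRstarN 1 α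

/-- The marginal law of a single observation `X ∼ f`. -/
noncomputable def Pmix : Measure 𝒳 := M.base.withDensity fun x => ENNReal.ofReal (M.f x)

/-- The law of `W = Lfdr(X)`, `X ∼ f`. -/
noncomputable def νW : Measure ℝ := M.Pmix.map M.Lfdr

/-- `G(t) = P(W ≤ t)`. -/
noncomputable def G (t : ℝ) : ℝ := (M.νW (Set.Iic t)).toReal

/-- `Ḡ(t) = P(W < t)`. -/
noncomputable def Gbar (t : ℝ) : ℝ := (M.νW (Set.Iio t)).toReal

/-- The generalized inverse `G^{-1}(u) = inf{t : G(t) ≥ u}`. -/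
noncomputable def Ginv (u : ℝ) : ℝ := sInf {t | u ≤ M.G t}

/-- `P(W = t)`. -/
noncomputable def atom (t : ℝ) : ℝ := (M.νW {t}).toReal

/-- The randomization probability `p(u)`, satisfying
`Ḡ(G^{-1}(u)) + p(u) P(W = G^{-1}(u)) = u`. -/
noncomputable def pu (u : ℝ) : ℝ := (u - M.Gbar (M.Ginv u)) / M.atom (M.Ginv u)

/-- `a(u) = E[W | S_u = 1]` for `u ∈ (0,1]`, `a(0) = 0`, where `S_u` is the Bernoulli(u)
thresholding variable of `W` at `G^{-1}(u)` with randomization `p(u)` at the boundary. -/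
noncomputable def a (u : ℝ) : ℝ :=
  if u = 0 then 0
  else ((∫ w in Set.Iio (M.Ginv u), w ∂M.νW) + M.pu u * (M.Ginv u * M.atom (M.Ginv u))) / u

/-- `b(u) = E[1 - W | S_u = 0]` for `u ∈ [0,1)`, `b(1) = 0`. -/
noncomputable def b (u : ℝ) : ℝ :=
  if u = 1 then 0
  else ((∫ w in Set.Ioi (M.Ginv u), (1 - w) ∂M.νW)
      + (1 - M.pu u) * ((1 - M.Ginv u) * M.atom (M.Ginv u))) / (1 - u)

/-- `b*(α) = inf{b(u) : u ∈ [0,1], a(u) ≤ α}`. -/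
noncomputable def bstar (α : ℝ) : ℝ :=
  sInf {y | ∃ u ∈ Set.Icc (0 : ℝ) 1, M.a u ≤ α ∧ y = M.b u}

/-- `u*(α) = sup{u ∈ [0,1] : a(u) ≤ α}`. -/
noncomputable def ustar (α : ℝ) : ℝ :=
  sSup {u | u ∈ Set.Icc (0 : ℝ) 1 ∧ M.a u ≤ α}

/-- `b**(α) = inf{E[b(U)] : U a [0,1]-valued random variable with E[a(U)] ≤ α}`. -/
noncomputable def bstarstar (α : ℝ) : ℝ :=
  sInf {y | ∃ ρ : Measure ℝ, IsProbabilityMeasure ρ ∧ (∀ᵐ u ∂ρ, u ∈ Set.Icc (0 : ℝ) 1) ∧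
    (∫ u, M.a u ∂ρ) ≤ α ∧ y = ∫ u, M.b u ∂ρ}

end Model

/-- The Bernoulli(p) measure on `Bool`. -/
noncomputable def bern (p : ℝ) : Measure Bool :=
  (ENNReal.ofReal p) • Measure.dirac true + (ENNReal.ofReal (1 - p)) • Measure.dirac false

namespace Model

variable {𝒳 : Type*} [MeasurableSpace 𝒳] (M : Model 𝒳)

/-- The per-observation rejection probability of the Neyman–Pearson rule at level `α`:
reject if `Lfdr(x) < G^{-1}(u*(α))`, randomize with probability `p(u*(α))` at equality,
and accept otherwise. -/
noncomputable def qNP (α : ℝ) (x : 𝒳) : ℝ :=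
  if M.Lfdr x < M.Ginv (M.ustar α) then 1
  else if M.Lfdr x = M.Ginv (M.ustar α) then M.pu (M.ustar α)
  else 0

/-- The Neyman–Pearson rule `δ^n_NP(α)`, as a Markov kernel: independent randomized
likelihood-ratio tests applied to each observation. -/
noncomputable def NP (α : ℝ) (n : ℕ) : (Fin n → 𝒳) → Measure (Fin n → Bool) :=
  fun x => Measure.pi fun i => bern (M.qNP α (x i))

/-- The probability (over data and the randomization of the rule `κ`) that the decision vector
lies in the set `E θ` (which may depend on the true labels `θ`). -/
noncomputable def prob (n : ℕ) (κ : (Fin n → 𝒳) → Measure (Fin n → Bool))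
    (E : (Fin n → Bool) → Set (Fin n → Bool)) : ℝ :=
  (∫⁻ ω, κ (fun i => (ω i).2) (E fun i => (ω i).1) ∂(M.jointN n)).toReal

end Model

/-- `sortedVal n w i` is the `i`-th order statistic `w_(i)` (for `1 ≤ i ≤ n`) of
`w 0, …, w (n-1)`. -/
noncomputable def sortedVal (n : ℕ) (w : Fin n → ℝ) (i : ℕ) : ℝ :=
  ((Multiset.map w Finset.univ.val).sort (· ≤ ·)).getD (i - 1) 0

/-- `avgLow n w k = (1/k) Σ_{i=1}^k w_(i)` (equal to `0` when `k = 0`). -/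
noncomputable def avgLow (n : ℕ) (w : Fin n → ℝ) (k : ℕ) : ℝ :=
  (∑ i ∈ Finset.Icc 1 k, sortedVal n w i) / k

/-- `avgHigh n w k = (1/(n-k)) Σ_{i=k+1}^n (1 - w_(i))` (equal to `0` when `k = n`). -/
noncomputable def avgHigh (n : ℕ) (w : Fin n → ℝ) (k : ℕ) : ℝ :=
  (∑ i ∈ Finset.Icc (k + 1) n, (1 - sortedVal n w i)) / ((n : ℝ) - k)

/-- The greatest convex minorant on `[0,1]` of a function `h`, evaluated at `α`. -/
noncomputable def gcm (h : ℝ → ℝ) (α : ℝ) : ℝ :=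
  sSup {y | ∃ C : ℝ → ℝ, ConvexOn ℝ (Set.Icc 0 1) C ∧
    (∀ t ∈ Set.Icc (0 : ℝ) 1, C t ≤ h t) ∧ y = C α}

end TwoGroup

namespace TwoGroup
theorem length_sort_map {n : ℕ} (w : Fin n → ℝ) :
    ((Multiset.map w Finset.univ.val).sort (· ≤ ·)).length = n := by simp

theorem sum_comp_sortedVal {n : ℕ} (w : Fin n → ℝ) (g : ℝ → ℝ) :
    ∑ i ∈ Finset.range n, g (sortedVal n w (i + 1)) = ∑ j, g (w j) := by
  have hl := length_sort_map w
  set l := (Multiset.map w Finset.univ.val).sort (· ≤ ·) with hdef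
  calc ∑ i ∈ Finset.range n, g (sortedVal n w (i + 1))
      = ∑ i ∈ Finset.range l.length, g (l.getD i 0) := by
        rw [hl]; rfl
    _ = ∑ i : Fin l.length, g l[i] := by
        rw [Finset.sum_range]; simp
    _ = (l.map g).sum := Fin.sum_univ_fun_getElem l g
    _ = (Multiset.map g (l : Multiset ℝ)).sum := by simp
    _ = ∑ j, g (w j) := by
        rw [hdef, Multiset.sort_eq, Multiset.map_map]; rfl

theorem sortedVal_mono {n : ℕ} (w : Fin n → ℝ) {i j : ℕ} (hij : i ≤ j) (hj : j < n) :
    sortedVal n w (i + 1) ≤ sortedVal n w (j + 1) := by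
  have hl := length_sort_map w
  have hp := Multiset.pairwise_sort (Multiset.map w Finset.univ.val) (· ≤ ·)
  unfold sortedVal
  set l := (Multiset.map w Finset.univ.val).sort (· ≤ ·) with hdef
  have h1 : i < l.length := by omega
  have h2 : j < l.length := by omega
  simpa [List.getD_eq_getElem, h1, h2] using
    hp.rel_get_of_le (a := ⟨i, h1⟩) (b := ⟨j, h2⟩) hij

theorem sortedVal_mem {n : ℕ} (w : Fin n → ℝ) {i : ℕ} (hi : i < n) :
    ∃ j, w j = sortedVal n w (i + 1) := by
  have hl := length_sort_map w
  have h1 : i < ((Multiset.map w Finset.univ.val).sort (· ≤ ·)).length := by omega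
  have h2 : sortedVal n w (i + 1) ∈ (Multiset.map w Finset.univ.val).sort (· ≤ ·) := by
    rw [sortedVal, Nat.add_sub_cancel, List.getD_eq_getElem _ _ h1]
    exact List.getElem_mem h1
  simpa using (Multiset.mem_sort _).1 h2

theorem sum_Icc_sortedVal {n : ℕ} (w : Fin n → ℝ) (k : ℕ) (g : ℝ → ℝ) :
    ∑ i ∈ Finset.Icc 1 k, g (sortedVal n w i) =
      ∑ i ∈ Finset.range k, g (sortedVal n w (i + 1)) := by
  rw [Finset.range_eq_Ico, Finset.sum_Ico_add' (fun i => g (sortedVal n w i)) 0 k 1]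
  rfl

theorem mul_sub_sum_le_sum_sortedVal {n : ℕ} (w : Fin n → ℝ) {k : ℕ} (hk : k ≤ n) (c : ℝ) :
    k * c - ∑ j, max (c - w j) 0 ≤ ∑ i ∈ Finset.Icc 1 k, sortedVal n w i := by
  rw [sum_Icc_sortedVal w k (fun x => x), ← sum_comp_sortedVal w (fun x => max (c - x) 0)]
  have h1 : ∑ i ∈ Finset.range k, max (c - sortedVal n w (i + 1)) 0 ≤
      ∑ i ∈ Finset.range n, max (c - sortedVal n w (i + 1)) 0 :=
    Finset.sum_le_sum_of_subset_of_nonneg (Finset.range_subset_range.2 hk)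
      fun _ _ _ => le_max_right _ _
  have h2 : ∑ i ∈ Finset.range k, (c - sortedVal n w (i + 1)) ≤
      ∑ i ∈ Finset.range k, max (c - sortedVal n w (i + 1)) 0 :=
    Finset.sum_le_sum fun _ _ => le_max_left _ _
  rw [Finset.sum_sub_distrib] at h2
  simp only [Finset.sum_const, Finset.card_range, nsmul_eq_mul] at h2
  linarith

theorem exists_sum_sortedVal_le {n : ℕ} (w : Fin n → ℝ)
    (hw : ∀ j, w j ∈ Set.Icc (0 : ℝ) 1) {k : ℕ} (hk : k ≤ n) :
    ∃ c ∈ Set.Icc (0 : ℝ) 1,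
      ∑ i ∈ Finset.Icc 1 k, sortedVal n w i ≤ k * c - ∑ j, max (c - w j) 0 := by
  rcases k with _ | k
  · refine ⟨0, by simp, ?_⟩
    have : ∑ j, max (0 - w j) 0 = 0 :=
      Finset.sum_eq_zero fun j _ => max_eq_right (by linarith [(hw j).1])
    simp only [this]; simp
  · set c := sortedVal n w (k + 1) with hc
    obtain ⟨j, hj⟩ := sortedVal_mem w (show k < n by omega)
    refine ⟨c, by rw [hc, ← hj]; exact hw j, ?_⟩
    rw [sum_Icc_sortedVal w _ (fun x => x), ← sum_comp_sortedVal w (fun x => max (c - x) 0),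
      ← Finset.sum_subset (Finset.range_subset_range.2 hk)]
    · rw [Finset.sum_congr rfl fun i hi => max_eq_left (sub_nonneg.2
        (sortedVal_mono w (Nat.lt_succ_iff.1 (Finset.mem_range.1 hi)) (by omega))),
        Finset.sum_sub_distrib]
      simp [hc]
    · intro i hi hi'
      simp only [Finset.mem_range, not_lt] at hi hi'
      exact max_eq_right (sub_nonpos.2 (sortedVal_mono w (by omega) hi))

/-- The empirical mean of the hinge `(c - w)₊`. -/
noncomputable def hingeMean {n : ℕ} (w : Fin n → ℝ) (c : ℝ) : ℝ :=
  (∑ j, max (c - w j) 0) / n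

theorem abs_max_sub_sub_max_sub_le (c d w : ℝ) :
    |max (c - w) 0 - max (d - w) 0| ≤ |c - d| := by
  simpa using abs_max_sub_max_le_abs (c - w) (d - w) 0

theorem abs_hingeMean_sub_le {n : ℕ} (hn : 0 < n) (w : Fin n → ℝ) (c d : ℝ) :
    |hingeMean w c - hingeMean w d| ≤ |c - d| := by
  have hn' : (0 : ℝ) < n := Nat.cast_pos.2 hn
  rw [hingeMean, hingeMean, ← sub_div, ← Finset.sum_sub_distrib, abs_div, abs_of_pos hn',
    div_le_iff₀ hn']
  refine (Finset.abs_sum_le_sum_abs _ _).trans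
    ((Finset.sum_le_sum fun j _ => abs_max_sub_sub_max_sub_le c d (w j)).trans ?_)
  simp [mul_comm]

namespace Model

variable {𝒳 : Type*} [MeasurableSpace 𝒳] (M : Model 𝒳)

theorem π1_nonneg : 0 ≤ M.π1 := by
  have := M.π0_mem.2
  unfold π1; linarith

theorem measurable_f : Measurable M.f :=
  (M.f0_meas.const_mul _).add (M.f1_meas.const_mul _)

theorem measurable_Lfdr : Measurable M.Lfdr :=
  (M.f0_meas.const_mul _).div M.measurable_f

theorem Lfdr_mem (x : 𝒳) : M.Lfdr x ∈ Set.Icc (0 : ℝ) 1 := by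
  have h0 : 0 ≤ M.π0 * M.f0 x := mul_nonneg M.π0_mem.1.le (M.f0_nonneg x)
  have h1 : 0 ≤ M.π1 * M.f1 x := mul_nonneg M.π1_nonneg (M.f1_nonneg x)
  exact ⟨div_nonneg h0 (add_nonneg h0 h1),
    div_le_one_of_le₀ (le_add_of_nonneg_right h1) (add_nonneg h0 h1)⟩

theorem isProbabilityMeasure_joint : IsProbabilityMeasure M.joint := by
  have := M.f0_prob
  have := M.f1_prob
  constructor
  rw [joint, Measure.add_apply, Measure.smul_apply, Measure.smul_apply, measure_univ,
    measure_univ, smul_eq_mul, smul_eq_mul, mul_one, mul_one,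
    ← ENNReal.ofReal_add M.π0_mem.1.le M.π1_nonneg, π1]
  simp

theorem map_snd_joint : M.joint.map Prod.snd = M.Pmix := by
  have := M.f0_prob
  have := M.f1_prob
  rw [joint, Measure.map_add _ _ measurable_snd, Measure.map_smul, Measure.map_smul,
    Measure.map_snd_prod, Measure.map_snd_prod, measure_univ, measure_univ, one_smul, one_smul,
    Pmix, ← withDensity_smul _ M.f0_meas.ennreal_ofReal,
    ← withDensity_smul _ M.f1_meas.ennreal_ofReal,
    ← withDensity_add_left (M.f0_meas.ennreal_ofReal.const_smul _)]
  congr 1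
  ext x
  simp only [Pi.add_apply, Pi.smul_apply, smul_eq_mul, f]
  rw [ENNReal.ofReal_add (mul_nonneg M.π0_mem.1.le (M.f0_nonneg x))
    (mul_nonneg M.π1_nonneg (M.f1_nonneg x)), ENNReal.ofReal_mul M.π0_mem.1.le,
    ENNReal.ofReal_mul M.π1_nonneg]

theorem map_Lfdr_joint : M.joint.map (fun p => M.Lfdr p.2) = M.νW := by
  rw [νW, ← M.map_snd_joint, Measure.map_map M.measurable_Lfdr measurable_snd]
  rfl

instance : IsProbabilityMeasure M.νW := by
  have := M.isProbabilityMeasure_joint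
  rw [← M.map_Lfdr_joint]
  exact Measure.isProbabilityMeasure_map (M.measurable_Lfdr.comp measurable_snd).aemeasurable

theorem ae_mem_νW : ∀ᵐ w ∂M.νW, w ∈ Set.Icc (0 : ℝ) 1 := by
  refine (ae_map_iff M.measurable_Lfdr.aemeasurable measurableSet_Icc).2 ?_
  exact Eventually.of_forall M.Lfdr_mem

theorem νW_compl_Icc : M.νW (Set.Icc (0 : ℝ) 1)ᶜ = 0 :=
  mem_ae_iff.1 (Filter.eventually_mem_set.1 M.ae_mem_νW)

theorem integrable_id_νW : Integrable (fun w => w) M.νW :=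
  Integrable.of_bound measurable_id.aestronglyMeasurable 1 (by
    filter_upwards [M.ae_mem_νW] with w hw
    rw [Real.norm_eq_abs, abs_of_nonneg hw.1]; exact hw.2)

/-- The expected hinge `E[(c - W)₊]`. -/
noncomputable def hinge (c : ℝ) : ℝ := ∫ w, max (c - w) 0 ∂M.νW

theorem integrable_hinge (c : ℝ) : Integrable (fun w => max (c - w) 0) M.νW :=
  ((integrable_const c).sub M.integrable_id_νW).pos_part

theorem Gbar_eq_zero : M.Gbar 0 = 0 := by
  have : M.νW (Set.Iio 0) = 0 := by
    refine measure_mono_null ?_ M.νW_compl_Icc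
    exact fun w hw h => not_le.2 hw h.1
  simp [Gbar, this]

theorem G_eq_zero_of_neg {t : ℝ} (ht : t < 0) : M.G t = 0 := by
  have : M.νW (Set.Iic t) = 0 := by
    refine measure_mono_null ?_ M.νW_compl_Icc
    exact fun w hw h => not_le.2 (lt_of_le_of_lt hw ht) h.1
  simp [G, this]

theorem G_one : M.G 1 = 1 := by
  have : M.νW (Set.Iic 1) = 1 := by
    refine (prob_compl_eq_zero_iff measurableSet_Iic).1 (measure_mono_null ?_ M.νW_compl_Icc)
    exact fun w hw h => hw h.2
  simp [G, this]

theorem G_eq_cdf (t : ℝ) : M.G t = cdf M.νW t := (cdf_eq_real _ _).symm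

theorem G_eq_Gbar_add_atom (t : ℝ) : M.G t = M.Gbar t + M.atom t := by
  have h : Set.Iio t ∪ {t} = Set.Iic t := Set.Iio_union_right
  unfold G Gbar atom
  rw [← h, measure_union (by simp) (measurableSet_singleton t),
    ENNReal.toReal_add (measure_ne_top _ _) (measure_ne_top _ _)]

theorem Ginv_zero : M.Ginv 0 = 0 := by
  have : {t | 0 ≤ M.G t} = Set.univ := Set.eq_univ_of_forall fun t => ENNReal.toReal_nonneg
  rw [Ginv, this, Real.sInf_univ]

theorem zero_mem_lowerBounds_setOf_le_G {u : ℝ} (hu : 0 < u) :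
    0 ∈ lowerBounds {t | u ≤ M.G t} := by
  intro t ht
  by_contra! h
  have h' : u ≤ M.G t := ht
  rw [M.G_eq_zero_of_neg h] at h'
  linarith

theorem Ginv_mem {u : ℝ} (hu : u ∈ Set.Icc (0 : ℝ) 1) : M.Ginv u ∈ Set.Icc (0 : ℝ) 1 := by
  rcases hu.1.eq_or_lt with rfl | h
  · simp [M.Ginv_zero]
  · have h1 : (1 : ℝ) ∈ {t | u ≤ M.G t} := by simpa [M.G_one] using hu.2
    exact ⟨le_csInf ⟨1, h1⟩ (M.zero_mem_lowerBounds_setOf_le_G h),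
      csInf_le ⟨0, M.zero_mem_lowerBounds_setOf_le_G h⟩ h1⟩

theorem le_G_Ginv {u : ℝ} (hu : u ∈ Set.Icc (0 : ℝ) 1) : u ≤ M.G (M.Ginv u) := by
  rcases hu.1.eq_or_lt with rfl | h
  · exact ENNReal.toReal_nonneg
  · have h1 : (1 : ℝ) ∈ {t | u ≤ M.G t} := by simpa [M.G_one] using hu.2
    have hr : Tendsto M.G (nhdsWithin (M.Ginv u) (Set.Ioi (M.Ginv u))) (nhds (M.G (M.Ginv u))) := by
      have := ((cdf M.νW).right_continuous (M.Ginv u)).mono Set.Ioi_subset_Ici_self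
      rw [show M.G = cdf M.νW from funext M.G_eq_cdf]
      exact this
    refine ge_of_tendsto hr ?_
    filter_upwards [self_mem_nhdsWithin] with s hs
    obtain ⟨t, ht, hts⟩ := exists_lt_of_csInf_lt ⟨1, h1⟩ (show sInf {t | u ≤ M.G t} < s from hs)
    refine le_trans (show u ≤ M.G t from ht) ?_
    rw [G_eq_cdf, G_eq_cdf]
    exact monotone_cdf _ hts.le

theorem Gbar_Ginv_le {u : ℝ} (hu : u ∈ Set.Icc (0 : ℝ) 1) : M.Gbar (M.Ginv u) ≤ u := by
  rcases hu.1.eq_or_lt with rfl | h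
  · rw [M.Ginv_zero, M.Gbar_eq_zero]
  · have hlt : ∀ s < M.Ginv u, M.νW (Set.Iic s) ≤ ENNReal.ofReal u := by
      intro s hs
      by_contra! hc
      have h2 : u ≤ M.G s := by
        rw [G, ← ENNReal.ofReal_le_iff_le_toReal (measure_ne_top _ _)]
        exact hc.le
      exact absurd (csInf_le ⟨0, M.zero_mem_lowerBounds_setOf_le_G h⟩ h2) (not_le.2 hs)
    refine ENNReal.toReal_le_of_le_ofReal h.le ?_
    obtain ⟨s, hs, hs', hst⟩ := exists_seq_strictMono_tendsto (M.Ginv u)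
    have hU : ⋃ n, Set.Iic (s n) = Set.Iio (M.Ginv u) := iUnion_Iic_eq_Iio_of_lt_of_tendsto hs' hst
    rw [← hU]
    exact le_of_tendsto (tendsto_measure_iUnion_atTop
      (fun i j hij => Set.Iic_subset_Iic.2 (hs.monotone hij)))
      (Eventually.of_forall fun n => hlt _ (hs' n))

/-- The optimal value of `c ↦ u c - E[(c - W)₊]`, attained at the `u`-quantile. -/
noncomputable def lorenz (u : ℝ) : ℝ := u * M.Ginv u - M.hinge (M.Ginv u)

theorem pu_mul_atom {u : ℝ} (hu : u ∈ Set.Icc (0 : ℝ) 1) :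
    M.pu u * M.atom (M.Ginv u) = u - M.Gbar (M.Ginv u) := by
  rw [pu]
  refine div_mul_cancel_of_imp fun h => ?_
  have h1 := M.le_G_Ginv hu
  have h2 := M.Gbar_Ginv_le hu
  rw [G_eq_Gbar_add_atom] at h1
  linarith

theorem setIntegral_Iio (t : ℝ) :
    ∫ w in Set.Iio t, w ∂M.νW = M.Gbar t * t - M.hinge t := by
  have h : M.hinge t = ∫ w in Set.Iio t, (t - w) ∂M.νW := by
    rw [hinge, ← integral_indicator measurableSet_Iio]
    congr 1
    ext w
    by_cases hw : w < t
    · rw [Set.indicator_of_mem (show w ∈ Set.Iio t from hw), max_eq_left (by linarith)]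
    · rw [Set.indicator_of_notMem (show w ∉ Set.Iio t from hw), max_eq_right (by linarith)]
  rw [h, integral_sub (integrable_const _).integrableOn M.integrable_id_νW.integrableOn]
  simp [Gbar, Measure.real]

theorem mul_a {u : ℝ} (hu : u ∈ Set.Ioc (0 : ℝ) 1) : u * M.a u = M.lorenz u := by
  have hu' : u ∈ Set.Icc (0 : ℝ) 1 := ⟨hu.1.le, hu.2⟩
  rw [a, if_neg hu.1.ne', mul_div_cancel₀ _ hu.1.ne', setIntegral_Iio, lorenz]
  linear_combination M.Ginv u * M.pu_mul_atom hu'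

theorem mul_b {u : ℝ} (hu : u ∈ Set.Ico (0 : ℝ) 1) :
    (1 - u) * M.b u = M.hinge 1 - u + M.lorenz u := by
  have hu' : u ∈ Set.Icc (0 : ℝ) 1 := ⟨hu.1, hu.2.le⟩
  set t := M.Ginv u with ht
  have h1 : M.hinge 1 = ∫ w, (1 - w) ∂M.νW := by
    refine integral_congr_ae ?_
    filter_upwards [M.ae_mem_νW] with w hw
    exact max_eq_left (by linarith [hw.2])
  have hint : Integrable (fun w => 1 - w) M.νW := (integrable_const 1).sub M.integrable_id_νW
  have h2 : ∫ w in Set.Ioi t, (1 - w) ∂M.νW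
      = M.hinge 1 - (M.G t - (∫ w in Set.Iio t, w ∂M.νW) - t * M.atom t) := by
    have h3 := integral_add_compl (measurableSet_Iic (a := t)) hint
    rw [Set.compl_Iic] at h3
    have h4 : ∫ w in Set.Iic t, w ∂M.νW = (∫ w in Set.Iio t, w ∂M.νW) + t * M.atom t := by
      rw [← Set.Iio_union_right, setIntegral_union (by simp) (measurableSet_singleton t)
        M.integrable_id_νW.integrableOn M.integrable_id_νW.integrableOn]
      simp [atom, mul_comm]
    have h5 : ∫ w in Set.Iic t, (1 - w) ∂M.νW = M.G t - ∫ w in Set.Iic t, w ∂M.νW := by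
      rw [integral_sub (integrable_const _).integrableOn M.integrable_id_νW.integrableOn]
      simp [G, Measure.real]
    rw [h1]
    linarith
  rw [b, if_neg hu.2.ne, mul_div_cancel₀ _ (sub_ne_zero.2 hu.2.ne')]
  rw [← ht, h2, setIntegral_Iio, G_eq_Gbar_add_atom, lorenz, ← ht]
  linear_combination (t - 1) * M.pu_mul_atom hu'

theorem mul_sub_hinge_le_lorenz {u : ℝ} (hu : u ∈ Set.Icc (0 : ℝ) 1) (c : ℝ) :
    u * c - M.hinge c ≤ M.lorenz u := by
  set t := M.Ginv u with ht
  have key : ∀ s : Set ℝ, MeasurableSet s →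
      (∀ w, s.indicator (fun _ => c - t) w ≤ max (c - w) 0 - max (t - w) 0) →
      M.νW.real s * (c - t) ≤ M.hinge c - M.hinge t := by
    intro s hs h
    have h1 := integral_mono (μ := M.νW) ((integrable_const (c - t)).indicator hs)
      ((M.integrable_hinge c).sub (M.integrable_hinge t)) h
    rw [integral_indicator hs] at h1
    simp only [Pi.sub_apply] at h1
    rw [integral_sub (M.integrable_hinge c) (M.integrable_hinge t)] at h1
    simpa [hinge] using h1
  rw [lorenz, ← ht]
  rcases le_total t c with h | h
  · have h1 := key (Set.Iic t) measurableSet_Iic fun w => by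
      by_cases hw : w ≤ t
      · rw [Set.indicator_of_mem (show w ∈ Set.Iic t from hw), max_eq_left (by linarith),
          max_eq_left (by linarith)]; linarith
      · rw [Set.indicator_of_notMem (show w ∉ Set.Iic t from hw),
          max_eq_right (by linarith : t - w ≤ 0), sub_zero]
        exact le_max_right _ _
    have h2 := M.le_G_Ginv hu
    have h3 : M.νW.real (Set.Iic t) = M.G t := rfl
    rw [← ht] at h2
    nlinarith
  · have h1 := key (Set.Iio t) measurableSet_Iio fun w => by
      by_cases hw : w < t
      · rw [Set.indicator_of_mem (show w ∈ Set.Iio t from hw),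
          max_eq_left (by linarith : 0 ≤ t - w)]
        linarith [le_max_left (c - w) 0]
      · rw [Set.indicator_of_notMem (show w ∉ Set.Iio t from hw),
          max_eq_right (by linarith : t - w ≤ 0), sub_zero]
        exact le_max_right _ _
    have h2 := M.Gbar_Ginv_le hu
    have h3 : M.νW.real (Set.Iio t) = M.Gbar t := rfl
    rw [← ht] at h2
    nlinarith

theorem abs_hinge_sub_le (c d : ℝ) : |M.hinge c - M.hinge d| ≤ |c - d| := by
  rw [hinge, hinge, ← integral_sub (M.integrable_hinge c) (M.integrable_hinge d)]
  have h := norm_integral_le_of_norm_le_const (μ := M.νW) (C := |c - d|)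
    (f := fun w => max (c - w) 0 - max (d - w) 0)
    (Eventually.of_forall fun w => abs_max_sub_sub_max_sub_le c d w)
  simpa using h

theorem jointN_hingeMean_deviation_le {n : ℕ} (hn : 0 < n) {c : ℝ} (hc : c ∈ Set.Icc (0 : ℝ) 1)
    {δ : ℝ} (hδ : 0 < δ) :
    M.jointN n {ω | δ ≤ |hingeMean (fun j => M.Lfdr (ω j).2) c - M.hinge c|} ≤
      ENNReal.ofReal (1 / (n * δ ^ 2)) := by
  have := M.isProbabilityMeasure_joint
  have hn' : (0 : ℝ) < n := Nat.cast_pos.2 hn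
  let h : Bool × 𝒳 → ℝ := fun p => max (c - M.Lfdr p.2) 0
  have hm : Measurable h :=
    (measurable_const.sub (M.measurable_Lfdr.comp measurable_snd)).max measurable_const
  have hb : ∀ p, h p ∈ Set.Icc (0 : ℝ) 1 := fun p =>
    ⟨le_max_right _ _, max_le (by linarith [hc.2, (M.Lfdr_mem p.2).1]) zero_le_one⟩
  have hL : MemLp h 2 M.joint := MemLp.of_bound hm.aestronglyMeasurable 1
    (Eventually.of_forall fun p => by
      rw [Real.norm_eq_abs, abs_of_nonneg (hb p).1]; exact (hb p).2)
  have hmean : ∫ p, h p ∂M.joint = M.hinge c := by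
    have hL : Measurable fun p : Bool × 𝒳 => M.Lfdr p.2 := M.measurable_Lfdr.comp measurable_snd
    rw [hinge, ← M.map_Lfdr_joint, integral_map hL.aemeasurable (by fun_prop)]
  have hLi : ∀ i : Fin n, MemLp (fun ω : Fin n → Bool × 𝒳 => h (ω i)) 2 (M.jointN n) :=
    fun i => hL.comp_measurePreserving (measurePreserving_eval (fun _ : Fin n => M.joint) i)
  have hprob : IsProbabilityMeasure (M.jointN n) := by unfold jointN; infer_instance
  have hsum : MemLp (∑ i : Fin n, fun ω : Fin n → Bool × 𝒳 => h (ω i)) 2 (M.jointN n) :=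
    memLp_finsetSum' _ fun i _ => hLi i
  have hvar : Var[∑ i : Fin n, fun ω : Fin n → Bool × 𝒳 => h (ω i); M.jointN n] ≤ n := by
    rw [jointN, variance_sum_pi fun _ => hL]
    have hv := variance_le_sq_of_bounded (μ := M.joint) (Eventually.of_forall hb) hm.aemeasurable
    simp only [Finset.sum_const, Finset.card_univ, Fintype.card_fin, nsmul_eq_mul]
    nlinarith
  have hE : (M.jointN n)[∑ i : Fin n, fun ω : Fin n → Bool × 𝒳 => h (ω i)] = n * M.hinge c := by
    simp only [Finset.sum_apply]
    rw [integral_finsetSum _ fun i _ => (hLi i).integrable one_le_two]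
    have hi : ∀ i : Fin n, ∫ ω, h (ω i) ∂M.jointN n = M.hinge c := fun i => by
      rw [← hmean, ← (measurePreserving_eval (fun _ : Fin n => M.joint) i).map_eq,
        integral_map (measurable_pi_apply i).aemeasurable hm.aestronglyMeasurable]
      rfl
    simp [hi]
  have hcheb := meas_ge_le_variance_div_sq hsum (mul_pos hn' hδ)
  rw [hE] at hcheb
  refine (measure_mono fun ω hω => ?_).trans (hcheb.trans (ENNReal.ofReal_le_ofReal ?_))
  · have hω' : δ ≤ |hingeMean (fun j => M.Lfdr (ω j).2) c - M.hinge c| := hω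
    have : (n : ℝ) * (hingeMean (fun j => M.Lfdr (ω j).2) c - M.hinge c) =
        (∑ i : Fin n, fun ω : Fin n → Bool × 𝒳 => h (ω i)) ω - n * M.hinge c := by
      rw [mul_sub, hingeMean, mul_div_cancel₀ _ hn'.ne', Finset.sum_apply]
    rw [Set.mem_ofPred_eq, ← this, abs_mul, abs_of_pos hn']
    exact mul_le_mul_of_nonneg_left hω' hn'.le
  · calc _ ≤ (n : ℝ) / (n * δ) ^ 2 := by gcongr
      _ = 1 / (n * δ ^ 2) := by field_simp

theorem tendsto_lintegral_of_uniform
    {K : ∀ n : ℕ, (Fin n → 𝒳) → Measure ℕ}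
    (hKprob : ∀ n x, IsProbabilityMeasure (K n x))
    (hKsupp : ∀ n x, K n x {k | n < k} = 0)
    {δ : ℝ} (hδ : 0 < δ) (E : ∀ n, (Fin n → Bool × 𝒳) → Set ℕ)
    (hE : ∀ n, 0 < n → ∀ ω : Fin n → Bool × 𝒳,
      (∀ c ∈ Set.Icc (0 : ℝ) 1,
        |hingeMean (fun j => M.Lfdr (ω j).2) c - M.hinge c| ≤ 3 * δ) → ∀ k ∈ E n ω, n < k) :
    Tendsto (fun n => (∫⁻ ω, K n (fun i => (ω i).2) (E n ω) ∂(M.jointN n)).toReal)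
      atTop (nhds 0) := by
  obtain ⟨m, hm⟩ := exists_nat_one_div_lt hδ
  set N : ℕ := m + 1 with hN
  have hN0 : (0 : ℝ) < N := by positivity
  have hNδ : 1 / (N : ℝ) < δ := by rw [hN]; push_cast; exact hm
  have hbound : ∀ n : ℕ, 0 < n →
      (∫⁻ ω, K n (fun i => (ω i).2) (E n ω) ∂(M.jointN n)).toReal ≤
        (N + 1) * (1 / δ ^ 2) * (1 / n) := by
    intro n hn
    have hn' : (0 : ℝ) < n := Nat.cast_pos.2 hn
    let B : Set (Fin n → Bool × 𝒳) := ⋃ j ∈ Finset.range (N + 1),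
      {ω | δ ≤ |hingeMean (fun i => M.Lfdr (ω i).2) (j / N) - M.hinge (j / N)|}
    have hB : M.jointN n B ≤ ENNReal.ofReal ((N + 1) * (1 / δ ^ 2) * (1 / n)) := by
      refine (measure_biUnion_finset_le _ _).trans ?_
      refine (Finset.sum_le_sum fun (j : ℕ) hj => M.jointN_hingeMean_deviation_le hn
        (c := j / N) ⟨div_nonneg (Nat.cast_nonneg j) hN0.le, ?_⟩ hδ).trans ?_
      · rw [div_le_one hN0]
        exact_mod_cast Nat.lt_succ_iff.1 (Finset.mem_range.1 hj)
      · rw [Finset.sum_const, Finset.card_range, nsmul_eq_mul, ← ENNReal.ofReal_natCast,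
          ← ENNReal.ofReal_mul (by positivity)]
        refine ENNReal.ofReal_le_ofReal (le_of_eq ?_)
        push_cast
        field_simp
    refine ENNReal.toReal_le_of_le_ofReal (by positivity) (le_trans ?_ hB)
    refine le_trans (lintegral_mono fun ω => ?_) (lintegral_indicator_one_le B)
    by_cases hω : ω ∈ B
    · rw [Set.indicator_of_mem hω]
      exact prob_le_one
    · rw [Set.indicator_of_notMem hω]
      refine (measure_mono_null (hE n hn ω fun c hc => ?_) (hKsupp n _)).le
      simp only [B, Set.mem_iUnion, not_exists, Set.mem_ofPred_eq, not_le] at hω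
      set j := ⌊c * N⌋₊ with hj
      have hcN : 0 ≤ c * N := mul_nonneg hc.1 hN0.le
      have hj1 : (j : ℝ) ≤ c * N := Nat.floor_le hcN
      have hj2 : c * N < j + 1 := Nat.lt_floor_add_one _
      have hjN : j ∈ Finset.range (N + 1) := by
        rw [Finset.mem_range, Nat.lt_succ_iff]
        have : (j : ℝ) ≤ N := hj1.trans (mul_le_of_le_one_left hN0.le hc.2)
        exact_mod_cast this
      have hcd : |c - j / N| ≤ δ := by
        have h1 : (j : ℝ) / N ≤ c := (div_le_iff₀ hN0).2 hj1
        have h2 : c < (j + 1) / N := (lt_div_iff₀ hN0).2 hj2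
        rw [add_div] at h2
        rw [abs_of_nonneg (by linarith)]
        linarith
      have e1 := abs_le.1 ((abs_hingeMean_sub_le hn (fun i => M.Lfdr (ω i).2) c (j / N)).trans hcd)
      have e2 := abs_le.1 ((M.abs_hinge_sub_le c (j / N)).trans hcd)
      have e3 := abs_lt.1 (hω j hjN)
      exact abs_le.2 ⟨by linarith [e1.1, e2.2, e3.1], by linarith [e1.2, e2.1, e3.2]⟩
  have hlim : Tendsto (fun n : ℕ => (N + 1) * (1 / δ ^ 2) * (1 / (n : ℝ))) atTop (nhds 0) := by
    have h : Tendsto (fun n : ℕ => 1 / (n : ℝ)) atTop (nhds 0) :=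
      tendsto_one_div_atTop_nhds_zero_nat
    simpa only [mul_zero] using h.const_mul ((N + 1 : ℝ) * (1 / δ ^ 2))
  refine squeeze_zero' (Eventually.of_forall fun _ => ENNReal.toReal_nonneg) ?_ hlim
  filter_upwards [eventually_gt_atTop 0] with n hn using hbound n hn

variable {n : ℕ} {w : Fin n → ℝ} {η : ℝ}

theorem abs_sum_sortedVal_sub_lorenz_le (hn : 0 < n) (hw : ∀ j, w j ∈ Set.Icc (0 : ℝ) 1)
    (hη : ∀ c ∈ Set.Icc (0 : ℝ) 1, |hingeMean w c - M.hinge c| ≤ η) {k : ℕ} (hk : k ≤ n) :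
    |(∑ i ∈ Finset.Icc 1 k, sortedVal n w i) / n - M.lorenz (k / n)| ≤ η := by
  have hn' : (0 : ℝ) < n := Nat.cast_pos.2 hn
  have hu : (k / n : ℝ) ∈ Set.Icc (0 : ℝ) 1 :=
    ⟨by positivity, (div_le_one hn').2 (by exact_mod_cast hk)⟩
  have hdiv : ∀ c, (k * c - ∑ j, max (c - w j) 0) / n = k / n * c - hingeMean w c := fun c => by
    rw [hingeMean]; ring
  rw [abs_le]
  constructor
  · have h1 := div_le_div_of_nonneg_right (mul_sub_sum_le_sum_sortedVal w hk (M.Ginv (k / n))) hn'.le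
    have h2 := abs_le.1 (hη _ (M.Ginv_mem hu))
    rw [hdiv] at h1
    rw [lorenz]
    linarith [h2.2]
  · obtain ⟨c, hc, h⟩ := exists_sum_sortedVal_le w hw hk
    have h1 := div_le_div_of_nonneg_right h hn'.le
    have h2 := abs_le.1 (hη c hc)
    have h3 := M.mul_sub_hinge_le_lorenz hu c
    rw [hdiv] at h1
    linarith [h2.1]

theorem abs_avgLow_sub_a_le {τ : ℝ} (hτ : 0 < τ) (hn : 0 < n)
    (hw : ∀ j, w j ∈ Set.Icc (0 : ℝ) 1)
    (hη : ∀ c ∈ Set.Icc (0 : ℝ) 1, |hingeMean w c - M.hinge c| ≤ η) {k : ℕ} (hk : k ≤ n)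
    (hkτ : τ * n ≤ k) : τ * |avgLow n w k - M.a (k / n)| ≤ η := by
  have hn' : (0 : ℝ) < n := Nat.cast_pos.2 hn
  have hk' : (0 : ℝ) < k := (mul_pos hτ hn').trans_le hkτ
  have hu : (k / n : ℝ) ∈ Set.Ioc (0 : ℝ) 1 :=
    ⟨by positivity, (div_le_one hn').2 (by exact_mod_cast hk)⟩
  have h1 := M.abs_sum_sortedVal_sub_lorenz_le hn hw hη hk
  have h2 : (∑ i ∈ Finset.Icc 1 k, sortedVal n w i) / n = k / n * avgLow n w k := by
    rw [avgLow]; field_simp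
  rw [h2, ← M.mul_a hu, ← mul_sub, abs_mul, abs_of_pos hu.1] at h1
  exact (mul_le_mul_of_nonneg_right ((le_div_iff₀ hn').2 hkτ) (abs_nonneg _)).trans h1

theorem abs_avgHigh_sub_b_le {τ : ℝ} (hτ : 0 < τ) (hn : 0 < n)
    (hw : ∀ j, w j ∈ Set.Icc (0 : ℝ) 1)
    (hη : ∀ c ∈ Set.Icc (0 : ℝ) 1, |hingeMean w c - M.hinge c| ≤ η) {k : ℕ} (hk : k ≤ n)
    (hkτ : (k : ℝ) ≤ (1 - τ) * n) : τ * |avgHigh n w k - M.b (k / n)| ≤ 2 * η := by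
  have hn' : (0 : ℝ) < n := Nat.cast_pos.2 hn
  have hkn : (0 : ℝ) < n - k := by nlinarith
  have hτu : τ ≤ 1 - k / n := by
    have := (div_le_iff₀ hn').2 hkτ
    linarith
  have hu : (k / n : ℝ) ∈ Set.Ico (0 : ℝ) 1 := ⟨by positivity, by linarith⟩
  have h1 := M.abs_sum_sortedVal_sub_lorenz_le hn hw hη hk
  have hone : hingeMean w 1 = (∑ i ∈ Finset.Icc 1 n, (1 - sortedVal n w i)) / n := by
    rw [hingeMean, sum_Icc_sortedVal w n (fun x => 1 - x), sum_comp_sortedVal w (fun x => 1 - x)]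
    congr 1
    exact Finset.sum_congr rfl fun j _ => max_eq_left (by linarith [(hw j).2])
  have hsplit : ∑ i ∈ Finset.Icc 1 n, (1 - sortedVal n w i) =
      (k - ∑ i ∈ Finset.Icc 1 k, sortedVal n w i) +
        ∑ i ∈ Finset.Icc (k + 1) n, (1 - sortedVal n w i) := by
    have h := Finset.sum_Ioc_consecutive (fun i => 1 - sortedVal n w i) (Nat.zero_le k) hk
    have h' : ∀ a b : ℕ, Finset.Ioc a b = Finset.Icc (a + 1) b := fun a b => by
      ext; simp
    simp only [h', zero_add] at h
    rw [← h, Finset.sum_sub_distrib]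
    simp
  have h2 : (1 - (k / n : ℝ)) * avgHigh n w k =
      hingeMean w 1 - k / n + (∑ i ∈ Finset.Icc 1 k, sortedVal n w i) / n := by
    rw [hone, hsplit, avgHigh]
    field_simp
    ring
  have h3 := hη 1 (by simp)
  have h4 : |(1 - (k / n : ℝ)) * (avgHigh n w k - M.b (k / n))| ≤ 2 * η := by
    rw [mul_sub, h2, M.mul_b hu, abs_le]
    rw [abs_le] at h1 h3
    exact ⟨by linarith [h1.1, h3.1], by linarith [h1.2, h3.2]⟩
  rw [abs_mul, abs_of_pos (by linarith [hu.2])] at h4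
  exact (mul_le_mul_of_nonneg_right hτu (abs_nonneg _)).trans h4

end Model

/-- **Uniform in-probability approximation along data-driven cutoffs** (Corollary 1). For any
`τ ∈ (0,1)` and any sequence of Markov kernels `K_n` from `𝒳^n` to `{0,1,…,n}`,
`((1/K_n) Σ_{i=1}^{K_n} W_(i) - a(K_n/n))·1{K_n ≥ τn} → 0` in probability and
`((1/(n-K_n)) Σ_{i=K_n+1}^n (1-W_(i)) - b(K_n/n))·1{K_n ≤ (1-τ)n} → 0` in probability. -/
theorem ordered_avg_inProbability {𝒳 : Type*} [MeasurableSpace 𝒳] (M : Model 𝒳)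
    (τ : ℝ) (hτ : τ ∈ Set.Ioo (0 : ℝ) 1)
    (K : ∀ n : ℕ, (Fin n → 𝒳) → Measure ℕ)
    (hKmeas : ∀ n, Measurable (K n))
    (hKprob : ∀ n x, IsProbabilityMeasure (K n x))
    (hKsupp : ∀ n x, K n x {k | n < k} = 0) :
    (∀ ε > (0 : ℝ),
      Filter.Tendsto
        (fun n =>
          (∫⁻ ω, K n (fun i => (ω i).2)
              {k | ε < |(avgLow n (fun j => M.Lfdr (ω j).2) k - M.a ((k : ℝ) / n)) *
                  (if τ * n ≤ (k : ℝ) then 1 else 0)|} ∂(M.jointN n)).toReal)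
        Filter.atTop (nhds 0)) ∧
    (∀ ε > (0 : ℝ),
      Filter.Tendsto
        (fun n =>
          (∫⁻ ω, K n (fun i => (ω i).2)
              {k | ε < |(avgHigh n (fun j => M.Lfdr (ω j).2) k - M.b ((k : ℝ) / n)) *
                  (if (k : ℝ) ≤ (1 - τ) * n then 1 else 0)|} ∂(M.jointN n)).toReal)
        Filter.atTop (nhds 0)) := by
  have hτ0 := hτ.1
  refine ⟨fun ε hε => ?_, fun ε hε => ?_⟩
  · refine M.tendsto_lintegral_of_uniform hKprob hKsupp (δ := ε * τ / 6) (by positivity) _ ?_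
    intro n hn ω hω k hk
    by_contra! hkn
    rw [Set.mem_ofPred_eq] at hk
    split_ifs at hk with h
    · have := M.abs_avgLow_sub_a_le hτ0 hn (fun j => M.Lfdr_mem _) hω hkn h
      rw [mul_one] at hk
      nlinarith
    · simp [hε.le.not_gt] at hk
  · refine M.tendsto_lintegral_of_uniform hKprob hKsupp (δ := ε * τ / 6) (by positivity) _ ?_
    intro n hn ω hω k hk
    by_contra! hkn
    rw [Set.mem_ofPred_eq] at hk
    split_ifs at hk with h
    · have := M.abs_avgHigh_sub_b_le hτ0 hn (fun j => M.Lfdr_mem _) hω hkn h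
      rw [mul_one] at hk
      nlinarith
    · simp [hε.le.not_gt] at hk

end TwoGroup
end

section
/- Let X and Y be random variables on a probability space with X taking values in [0,1] almost surely. If P(X ≤ α) ≥ 1 − τ for some α∈ℝ and τ∈[0,1], then P(E[X | Y] ≤ α + √τ) ≥ 1 − √τ, where E[X | Y] denotes the conditional expectation of X given Y. -/
open MeasureTheory Filter

/-- If `X ≤ 1` and `0 ≤ α`, then on any event `B` the integral of `X` exceeds `α P(B)` by at most
`P(X > α)`. -/
theorem setIntegral_le_const_mul_add_measureReal_gt {Ω : Type*} {_ : MeasurableSpace Ω}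
    {P : Measure Ω} [IsFiniteMeasure P] {X : Ω → ℝ} (hX : Measurable X) (hint : Integrable X P)
    (hX1 : ∀ᵐ ω ∂P, X ω ≤ 1) {α : ℝ} (hα : 0 ≤ α) (B : Set Ω) :
    ∫ ω in B, X ω ∂P ≤ α * P.real B + P.real {ω | α < X ω} := by
  have hA : MeasurableSet {ω | α < X ω} := measurableSet_lt measurable_const hX
  have hind : Integrable ({ω | α < X ω}.indicator fun _ ↦ (1 : ℝ)) (P.restrict B) :=
    (integrable_const 1).indicator hA
  calc ∫ ω in B, X ω ∂P
      ≤ ∫ ω in B, (α + {ω | α < X ω}.indicator (fun _ ↦ (1 : ℝ)) ω) ∂P := by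
        refine integral_mono_ae hint.integrableOn ((integrable_const α).add hind) ?_
        filter_upwards [ae_restrict_of_ae hX1] with ω hω
        by_cases hω' : α < X ω
        · simp [Set.indicator, hω']
          linarith
        · simpa [Set.indicator, hω'] using not_lt.1 hω'
    _ = α * P.real B + (P.restrict B).real {ω | α < X ω} := by
        rw [integral_add (integrable_const α) hind, integral_indicator_const _ hA]
        simp [mul_comm]
    _ ≤ α * P.real B + P.real {ω | α < X ω} := by
        gcongr
        exact ENNReal.toReal_mono (measure_ne_top _ _) (Measure.restrict_apply_le _ _)

/-- **A high-probability bound for conditional expectations** (Lemma 6). If `X ∈ [0,1]` a.s.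
and `P(X ≤ α) ≥ 1 - τ`, then `P(E[X|Y] ≤ α + √τ) ≥ 1 - √τ`, where `E[X|Y]` is the
conditional expectation of `X` given (the σ-algebra generated by) `Y`. -/
theorem condexp_high_prob_bound {Ω : Type*} [MeasurableSpace Ω]
    (P : Measure Ω) [IsProbabilityMeasure P]
    {β : Type*} [MeasurableSpace β]
    (X : Ω → ℝ) (Y : Ω → β) (hX : Measurable X) (hY : Measurable Y)
    (hX01 : ∀ᵐ ω ∂P, X ω ∈ Set.Icc (0 : ℝ) 1)
    (α τ : ℝ) (hτ : τ ∈ Set.Icc (0 : ℝ) 1)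
    (h : 1 - τ ≤ (P {ω | X ω ≤ α}).toReal) :
    1 - Real.sqrt τ ≤
      (P {ω | (P[X|MeasurableSpace.comap Y inferInstance]) ω ≤ α + Real.sqrt τ}).toReal := by
  have hint : Integrable X P := Integrable.of_mem_Icc 0 1 hX.aemeasurable hX01
  have hm := hY.comap_le
  have hsle : MeasurableSet {ω | X ω ≤ α} := measurableSet_le hX measurable_const
  have hA : P.real {ω | α < X ω} ≤ τ := by
    have := probReal_compl_eq_one_sub (μ := P) hsle
    have hc : {ω | X ω ≤ α}ᶜ = {ω | α < X ω} := by ext; simp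
    rw [hc] at this
    change 1 - τ ≤ P.real _ at h
    linarith
  generalize MeasurableSpace.comap Y inferInstance = m at hm ⊢
  have hBm : MeasurableSet[m] {ω | α + √τ < (P[X|m]) ω} :=
    stronglyMeasurable_condExp.measurable measurableSet_Ioi
  suffices hB : P.real {ω | α + √τ < (P[X|m]) ω} ≤ √τ by
    have := probReal_compl_eq_one_sub (μ := P) (hm _ hBm)
    have hc : {ω | α + √τ < (P[X|m]) ω}ᶜ = {ω | (P[X|m]) ω ≤ α + √τ} := by ext; simp
    rw [hc] at this
    change _ ≤ P.real _
    linarith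
  rcases hτ.1.eq_or_lt with rfl | hτ0
  · have hXα : X ≤ᵐ[P] fun _ ↦ α := by
      have h0 : P.real {ω | α < X ω} = 0 := le_antisymm hA measureReal_nonneg
      rw [measureReal_eq_zero_iff] at h0
      rw [EventuallyLE, ae_iff]
      simpa using h0
    have hmono := condExp_mono (m := m) hint (integrable_const α) hXα
    rw [condExp_const hm, EventuallyLE, ae_iff] at hmono
    have h0 : P {ω | α < (P[X|m]) ω} = 0 := by simpa using hmono
    simp [measureReal_def, h0]
  have hs : 0 < √τ := Real.sqrt_pos.2 hτ0
  rcases lt_or_ge α 0 with hα | hα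
  · have hP : P {ω | X ω ≤ α} = 0 := by
      rw [← compl_mem_ae_iff]
      filter_upwards [hX01] with ω hω
      simpa using hα.trans_le hω.1
    have : τ = 1 := le_antisymm hτ.2 (by simpa [hP] using h)
    simp [this]
  have hge : (α + √τ) * P.real {ω | α + √τ < (P[X|m]) ω} ≤
      ∫ ω in {ω | α + √τ < (P[X|m]) ω}, (P[X|m]) ω ∂P :=
    setIntegral_ge_of_const_le_real (hm _ hBm) (measure_ne_top _ _) (fun _ hω ↦ hω.le)
      integrable_condExp.integrableOn
  rw [setIntegral_condExp hm hint hBm] at hge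
  have hle := setIntegral_le_const_mul_add_measureReal_gt hX hint
    (hX01.mono fun _ hω ↦ hω.2) hα {ω | α + √τ < (P[X|m]) ω}
  refine le_of_mul_le_mul_left ?_ hs
  rw [Real.mul_self_sqrt hτ.1]
  linarith
end
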